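/- Langmann–Szabo invariance of the quartic Moyal interaction: for every real-valued φ ∈ 𝒮(ℝ^D, ℝ), ∫_{ℝ^D} (φ ⋆ φ ⋆ φ ⋆ φ)(x) dx = ∫_{ℝ^D} ( φ̂* ⋆ φ̂ ⋆ φ̂* ⋆ φ̂ )(k) dk, where φ̂ is the symplectic Fourier transform of φ and φ̂* denotes its pointwise complex conjugate (which equals the transform of φ taken with kernel e^{+i k∧x}); in particular both four-fold Moyal products are integrable and the quartic term of the action is invariant under the cyclic symplectic Fourier transformation. -/

import Mathlib

open MeasureTheory

noncomputable section

/-- The standard symplectic matrix `Σ` on `ℝ^D`: block-diagonal with `D/2` blocks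
`((0, -1), (1, 0))`. -/
def stdSigma (D : ℕ) : Matrix (Fin D) (Fin D) ℝ := fun i j =>
  if i.val % 2 = 1 ∧ i.val = j.val + 1 then 1
  else if j.val % 2 = 1 ∧ j.val = i.val + 1 then -1 else 0

/-- `Θ = θ Σ`. -/
def Theta (θ : ℝ) (D : ℕ) : Matrix (Fin D) (Fin D) ℝ := θ • stdSigma D

/-- `y ∧ z = 2 yᵀ Θ⁻¹ z`. -/
def wedge (θ : ℝ) {D : ℕ} (y z : EuclideanSpace ℝ (Fin D)) : ℝ :=
  2 * ∑ i, ∑ j, y i * (Theta θ D)⁻¹ i j * z j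

/-- The Moyal product `(f ⋆ g)(x) = (πθ)^{-D} ∬ f(x+y) g(x+z) e^{-i y∧z} dy dz`. -/
def moyal (θ : ℝ) {D : ℕ} (f g : EuclideanSpace ℝ (Fin D) → ℂ) :
    EuclideanSpace ℝ (Fin D) → ℂ := fun x =>
  ((Real.pi * θ) ^ D)⁻¹ •
    ∫ p : EuclideanSpace ℝ (Fin D) × EuclideanSpace ℝ (Fin D),
      f (x + p.1) * g (x + p.2) * Complex.exp (-(Complex.I) * (wedge θ p.1 p.2 : ℂ))

/-- The symplectic Fourier transform
`φ̂(k) = (πθ)^{−D/2} ∫ φ(x) e^{−i k∧x} dx`. -/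
def sympFourier (θ : ℝ) {D : ℕ} (φ : EuclideanSpace ℝ (Fin D) → ℂ) :
    EuclideanSpace ℝ (Fin D) → ℂ := fun k =>
  ((Real.pi * θ) ^ ((D : ℝ) / 2))⁻¹ •
    ∫ x : EuclideanSpace ℝ (Fin D), φ x * Complex.exp (-(Complex.I) * (wedge θ k x : ℂ))

/-- `ṽ_μ = 2 Θ⁻¹_{μν} v_ν`. -/
def tilde (θ : ℝ) {D : ℕ} (v : EuclideanSpace ℝ (Fin D)) (μ : Fin D) : ℝ :=
  2 * ∑ ν, (Theta θ D)⁻¹ μ ν * v ν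

open scoped FourierTransform SchwartzMap

theorem stdSigma_transpose (D : ℕ) : (stdSigma D).transpose = -stdSigma D := by
  ext i j
  simp only [Matrix.transpose_apply, Matrix.neg_apply, stdSigma]
  grind

theorem stdSigma_mul_self {D : ℕ} (hD : Even D) : stdSigma D * stdSigma D = -1 := by
  have entry_odd (i j : Fin D) (hi : i.val % 2 = 1) :
      stdSigma D i j = if i.val = j.val + 1 then 1 else 0 := by
    simp only [stdSigma]; grind
  have entry_even (i j : Fin D) (hi : i.val % 2 = 0) :
      stdSigma D i j = if j.val = i.val + 1 then -1 else 0 := by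
    simp only [stdSigma]; grind
  obtain ⟨m, hm⟩ := hD
  ext i k
  rw [Matrix.mul_apply, Matrix.neg_apply, Matrix.one_apply]
  rcases Nat.mod_two_eq_zero_or_one i.val with hi | hi
  · have hlt : i.val + 1 < D := by omega
    rw [Finset.sum_eq_single ⟨i.val + 1, hlt⟩]
    · rw [entry_even i _ hi, entry_odd _ k (by simp only; omega)]
      simp only [Fin.ext_iff]; grind
    · intro j _ hj
      rw [entry_even i j hi, if_neg (fun h => hj (Fin.ext h)), zero_mul]
    · simp
  · rw [Finset.sum_eq_single ⟨i.val - 1, by omega⟩]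
    · rw [entry_odd i _ hi, entry_even _ k (by simp only; omega)]
      simp only [Fin.ext_iff]; grind
    · intro j _ hj
      rw [entry_odd i j hi, if_neg (fun h => hj (Fin.ext (by simp only; omega))), zero_mul]
    · simp

theorem inv_Theta {θ : ℝ} (hθ : θ ≠ 0) {D : ℕ} (hD : Even D) :
    (Theta θ D)⁻¹ = -(θ⁻¹ • stdSigma D) := by
  apply Matrix.inv_eq_left_inv
  rw [Theta, Matrix.neg_mul, Matrix.smul_mul, Matrix.mul_smul, smul_smul, inv_mul_cancel₀ hθ,
    one_smul, stdSigma_mul_self hD, neg_neg]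

/-- The complex structure on `ℝ^D` given by the matrix `Σ`, as a linear isometry. -/
def sigmaIsometry {D : ℕ} (hD : Even D) :
    EuclideanSpace ℝ (Fin D) ≃ₗᵢ[ℝ] EuclideanSpace ℝ (Fin D) :=
  LinearIsometry.toLinearIsometryEquiv
    ((Matrix.toLpLin 2 2 (stdSigma D)).isometryOfInner fun x y => by
      simp only [EuclideanSpace.inner_eq_star_dotProduct, Matrix.ofLp_toLpLin, Matrix.toLin'_apply,
        star_trivial]
      rw [Matrix.dotProduct_mulVec, Matrix.vecMul_mulVec, ← Matrix.dotProduct_mulVec,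
        stdSigma_transpose, Matrix.neg_mul, stdSigma_mul_self hD, neg_neg, Matrix.one_mulVec]) rfl

theorem wedge_eq_inner {θ : ℝ} (hθ : θ ≠ 0) {D : ℕ} (hD : Even D)
    (y z : EuclideanSpace ℝ (Fin D)) :
    wedge θ y z = 2 / θ * inner ℝ z (sigmaIsometry hD y) := by
  have key : ∀ i, sigmaIsometry hD y i = ∑ j, stdSigma D i j * y j := fun i => rfl
  have hT : ∀ i j, stdSigma D j i = -stdSigma D i j := fun i j =>
    congrFun (congrFun (stdSigma_transpose D) i) j
  rw [PiLp.inner_apply, wedge, inv_Theta hθ hD, Finset.sum_comm, Finset.mul_sum, Finset.mul_sum]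
  refine Finset.sum_congr rfl fun j _ => ?_
  simp only [key, RCLike.inner_apply, conj_trivial, Finset.mul_sum, Finset.sum_mul]
  refine Finset.sum_congr rfl fun i _ => ?_
  rw [hT i j, Matrix.neg_apply, Matrix.smul_apply, smul_eq_mul]
  ring

theorem wedge_add_left (θ : ℝ) {D : ℕ} (x y z : EuclideanSpace ℝ (Fin D)) :
    wedge θ (x + y) z = wedge θ x z + wedge θ y z := by
  simp [wedge, add_mul, Finset.sum_add_distrib, mul_add]

theorem wedge_add_right (θ : ℝ) {D : ℕ} (x y z : EuclideanSpace ℝ (Fin D)) :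
    wedge θ x (y + z) = wedge θ x y + wedge θ x z := by
  simp [wedge, Finset.sum_add_distrib, mul_add]

theorem wedge_neg_left (θ : ℝ) {D : ℕ} (x y : EuclideanSpace ℝ (Fin D)) :
    wedge θ (-x) y = -wedge θ x y := by
  simp [wedge]

theorem wedge_neg_right (θ : ℝ) {D : ℕ} (x y : EuclideanSpace ℝ (Fin D)) :
    wedge θ x (-y) = -wedge θ x y := by
  simp [wedge]

theorem wedge_swap {θ : ℝ} (hθ : θ ≠ 0) {D : ℕ} (hD : Even D) (x y : EuclideanSpace ℝ (Fin D)) :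
    wedge θ y x = -wedge θ x y := by
  rw [wedge, wedge, Finset.sum_comm, ← mul_neg, ← Finset.sum_neg_distrib]
  congr 1
  refine Finset.sum_congr rfl fun i _ => ?_
  rw [← Finset.sum_neg_distrib]
  refine Finset.sum_congr rfl fun j _ => ?_
  have h := congrFun (congrFun (stdSigma_transpose D) i) j
  simp only [Matrix.transpose_apply, Matrix.neg_apply] at h
  simp only [inv_Theta hθ hD, Matrix.neg_apply, Matrix.smul_apply, h, smul_eq_mul]
  ring

theorem wedge_self {θ : ℝ} (hθ : θ ≠ 0) {D : ℕ} (hD : Even D) (x : EuclideanSpace ℝ (Fin D)) :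
    wedge θ x x = 0 := by
  linarith [wedge_swap hθ hD x x]

theorem continuous_wedge (θ : ℝ) {D : ℕ} : Continuous fun p :
    EuclideanSpace ℝ (Fin D) × EuclideanSpace ℝ (Fin D) => wedge θ p.1 p.2 := by
  unfold wedge
  fun_prop

theorem integrable_mul_exp_I {α : Type*} [MeasurableSpace α] {μ : Measure α} {f : α → ℂ}
    (hf : Integrable f μ) {u : α → ℝ} (hu : AEStronglyMeasurable u μ) :
    Integrable (fun a => f a * Complex.exp (Complex.I * u a)) μ := by
  refine hf.mul_bdd (c := 1) ?_ ?_
  · have hexp : Continuous fun t : ℝ => Complex.exp (Complex.I * t) := by fun_prop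
    exact hexp.comp_aestronglyMeasurable hu
  · exact .of_forall fun a => by rw [mul_comm, Complex.norm_exp_ofReal_mul_I]

theorem sympFourier_eq_fourier {θ : ℝ} (hθ : 0 < θ) {D : ℕ} (hD : Even D)
    (f : EuclideanSpace ℝ (Fin D) → ℂ) (k : EuclideanSpace ℝ (Fin D)) :
    sympFourier θ f k = ((Real.pi * θ) ^ ((D : ℝ) / 2))⁻¹ •
      𝓕 f ((Real.pi * θ)⁻¹ • sigmaIsometry hD k) := by
  rw [sympFourier, Real.fourier_eq']
  congr 1
  refine integral_congr_ae (.of_forall fun x => ?_)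
  simp only [smul_eq_mul]
  rw [mul_comm (f x), wedge_eq_inner hθ.ne' hD, inner_smul_right]
  congr 2
  push_cast
  have : (Real.pi : ℂ) ≠ 0 := by exact_mod_cast Real.pi_ne_zero
  have : (θ : ℂ) ≠ 0 := by exact_mod_cast hθ.ne'
  field_simp

theorem inv_rpow_half_mul_self {a : ℝ} (ha : 0 < a) (D : ℕ) :
    (a ^ ((D : ℝ) / 2))⁻¹ * (a ^ ((D : ℝ) / 2))⁻¹ = (a ^ D)⁻¹ := by
  rw [← mul_inv, ← Real.rpow_add ha, add_halves, Real.rpow_natCast]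

theorem integrable_sympFourier {θ : ℝ} (hθ : 0 < θ) {D : ℕ} (hD : Even D)
    (f : 𝓢(EuclideanSpace ℝ (Fin D), ℂ)) : Integrable (sympFourier θ f) := by
  rw [funext (sympFourier_eq_fourier hθ hD f)]
  refine Integrable.smul (_ : ℝ) ?_
  have h : Integrable (fun k => 𝓕 f ((Real.pi * θ)⁻¹ • k)) :=
    (𝓕 f).integrable.comp_smul (by positivity)
  exact (sigmaIsometry hD).measurePreserving.integrable_comp_of_integrable h

theorem sympFourier_sympFourier {θ : ℝ} (hθ : 0 < θ) {D : ℕ} (hD : Even D)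
    (f : 𝓢(EuclideanSpace ℝ (Fin D), ℂ)) : sympFourier θ (sympFourier θ f) = f := by
  ext x
  have hpos : 0 < Real.pi * θ := by positivity
  have inv : 𝓕⁻ (𝓕 f) x = f x := by rw [FourierTransform.fourierInv_fourier_eq]
  rw [SchwartzMap.fourierInv_coe, Real.fourierInv_eq'] at inv
  set G : EuclideanSpace ℝ (Fin D) → ℂ :=
    fun u => Complex.exp (↑(2 * Real.pi * inner ℝ u x) * Complex.I) • 𝓕 f u with hG
  have key : ∀ k, sympFourier θ f k * Complex.exp (-Complex.I * (wedge θ x k : ℂ)) =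
      ((Real.pi * θ) ^ ((D : ℝ) / 2))⁻¹ • G ((Real.pi * θ)⁻¹ • sigmaIsometry hD k) := fun k => by
    rw [sympFourier_eq_fourier hθ hD, hG]
    simp only [smul_eq_mul]
    rw [smul_mul_assoc, wedge_swap hθ.ne' hD k x, wedge_eq_inner hθ.ne' hD,
      real_inner_smul_left, real_inner_comm, SchwartzMap.fourier_coe]
    congr 1
    rw [mul_comm]
    congr 2
    push_cast
    have : (Real.pi : ℂ) ≠ 0 := by exact_mod_cast Real.pi_ne_zero
    have : (θ : ℂ) ≠ 0 := by exact_mod_cast hθ.ne'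
    field_simp
  have cov : ∫ k, G ((Real.pi * θ)⁻¹ • sigmaIsometry hD k) =
      (Real.pi * θ) ^ D • ∫ u, G u := by
    rw [(sigmaIsometry hD).measurePreserving.integral_comp
      (sigmaIsometry hD).toHomeomorph.measurableEmbedding (fun k => G ((Real.pi * θ)⁻¹ • k)),
      Measure.integral_comp_smul, finrank_euclideanSpace_fin, inv_pow, inv_inv,
      abs_of_pos (by positivity)]
  rw [sympFourier, integral_congr_ae (.of_forall key), integral_smul, cov, smul_smul, smul_smul,
    inv_rpow_half_mul_self hpos, inv_mul_cancel₀ (by positivity), one_smul, inv]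

section Moyal

variable {D : ℕ} {θ : ℝ} {f g : EuclideanSpace ℝ (Fin D) → ℂ}

theorem integrable_moyal_integrand (hf : Integrable f) (hg : Integrable (sympFourier θ g)) :
    Integrable (fun p : EuclideanSpace ℝ (Fin D) × EuclideanSpace ℝ (Fin D) =>
      f (p.1 + p.2) * sympFourier θ g p.2 *
        Complex.exp (Complex.I * (wedge θ p.2 p.1 : ℂ))) (volume.prod volume) := by
  refine integrable_mul_exp_I ?_
    ((continuous_wedge θ).comp continuous_swap).aestronglyMeasurable
  have h := (measurePreserving_prod_add_right (G := EuclideanSpace ℝ (Fin D))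
    volume volume).integrable_comp_of_integrable (hg.mul_prod hf)
  refine (h.swap).congr (.of_forall fun p => ?_)
  simp [mul_comm]

theorem moyal_eq_integral_sympFourier (hθ : 0 < θ)
    (hf : Integrable f) (hg : Integrable g) (x : EuclideanSpace ℝ (Fin D)) :
    moyal θ f g x = ((Real.pi * θ) ^ ((D : ℝ) / 2))⁻¹ •
      ∫ y, f (x + y) * sympFourier θ g y * Complex.exp (Complex.I * (wedge θ y x : ℂ)) := by
  have hint : Integrable (fun p : EuclideanSpace ℝ (Fin D) × EuclideanSpace ℝ (Fin D) =>
      f (x + p.1) * g (x + p.2) * Complex.exp (-Complex.I * (wedge θ p.1 p.2 : ℂ))) := by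
    refine (integrable_mul_exp_I ((hf.comp_add_left x).mul_prod (hg.comp_add_left x))
      (continuous_wedge θ).neg.aestronglyMeasurable).congr (.of_forall fun p => ?_)
    simp
  have inner (y : EuclideanSpace ℝ (Fin D)) :
      ∫ z, f (x + y) * g (x + z) * Complex.exp (-Complex.I * (wedge θ y z : ℂ)) =
      f (x + y) * Complex.exp (Complex.I * (wedge θ y x : ℂ)) *
        ∫ z, g z * Complex.exp (-Complex.I * (wedge θ y z : ℂ)) := by
    rw [← integral_const_mul]
    refine Eq.trans ?_ (integral_add_left_eq_self _ x)
    refine integral_congr_ae (.of_forall fun z => ?_)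
    simp only
    rw [wedge_add_right, Complex.ofReal_add, mul_add, Complex.exp_add]
    have h : Complex.exp (Complex.I * (wedge θ y x : ℂ)) *
        Complex.exp (-Complex.I * (wedge θ y x : ℂ)) = 1 := by
      rw [← Complex.exp_add, neg_mul, add_neg_cancel, Complex.exp_zero]
    linear_combination
      -(f (x + y) * g (x + z) * Complex.exp (-Complex.I * (wedge θ y z : ℂ))) * h
  rw [moyal, Measure.volume_eq_prod, integral_prod _ hint, ← inv_rpow_half_mul_self (by positivity),
    mul_smul, ← integral_smul]
  congr 1
  refine integral_congr_ae (.of_forall fun y => ?_)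
  simp only [inner, sympFourier, mul_smul_comm, smul_mul_assoc]
  rw [mul_right_comm]

theorem integrable_moyal (hθ : 0 < θ) (hf : Integrable f) (hg : Integrable g)
    (hg' : Integrable (sympFourier θ g)) : Integrable (moyal θ f g) := by
  rw [funext (moyal_eq_integral_sympFourier hθ hf hg)]
  exact (integrable_moyal_integrand hf hg').integral_prod_left.smul (_ : ℝ)

/-- The Moyal product is tracial: it may be replaced by the pointwise product under the
integral sign. -/
theorem integral_moyal (hθ : 0 < θ) (hD : Even D) (hf : Integrable f) (hg : Integrable g)
    (hg' : Integrable (sympFourier θ g)) :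
    ∫ x, moyal θ f g x = ∫ x, f x * sympFourier θ (sympFourier θ g) x := by
  have shift (y : EuclideanSpace ℝ (Fin D)) :
      ∫ x, f (x + y) * sympFourier θ g y * Complex.exp (Complex.I * (wedge θ y x : ℂ)) =
      ∫ x, f x * (sympFourier θ g y * Complex.exp (-Complex.I * (wedge θ x y : ℂ))) := by
    rw [← integral_add_right_eq_self (fun x => _ * (_ * _)) y]
    refine integral_congr_ae (.of_forall fun x => ?_)
    simp only
    rw [wedge_add_left, wedge_self hθ.ne' hD, wedge_swap hθ.ne' hD y x, mul_assoc]
    simp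
  have hint : Integrable (fun p : EuclideanSpace ℝ (Fin D) × EuclideanSpace ℝ (Fin D) =>
      f p.2 * (sympFourier θ g p.1 * Complex.exp (-Complex.I * (wedge θ p.2 p.1 : ℂ))))
      (volume.prod volume) := by
    refine (integrable_mul_exp_I (hg'.mul_prod hf)
      ((continuous_wedge θ).comp continuous_swap).neg.aestronglyMeasurable).congr
      (.of_forall fun p => ?_)
    simp
    ring
  rw [integral_congr_ae (.of_forall (moyal_eq_integral_sympFourier hθ hf hg)), integral_smul,
    integral_integral_swap (integrable_moyal_integrand hf hg'),
    integral_congr_ae (.of_forall shift), integral_integral_swap hint, ← integral_smul]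
  refine integral_congr_ae (.of_forall fun x => ?_)
  simp only
  rw [integral_const_mul, ← mul_smul_comm, ← sympFourier]

theorem moyal_moyal_eq_integral (hθ : 0 < θ) {h : EuclideanSpace ℝ (Fin D) → ℂ}
    (hf : Integrable f) (hg : Integrable g) (hg' : Integrable (sympFourier θ g))
    (hh : Integrable h) (x : EuclideanSpace ℝ (Fin D)) :
    moyal θ (moyal θ f g) h x = ((Real.pi * θ) ^ D)⁻¹ •
      ∫ y, ∫ z, f (x + y + z) * sympFourier θ g z * sympFourier θ h y *
        Complex.exp (Complex.I * (wedge θ z (x + y) + wedge θ y x : ℝ)) := by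
  rw [moyal_eq_integral_sympFourier hθ (integrable_moyal hθ hf hg hg') hh,
    ← inv_rpow_half_mul_self (by positivity), mul_smul]
  congr 1
  refine Eq.trans ?_ (integral_smul _ _)
  refine integral_congr_ae (.of_forall fun y => ?_)
  simp only
  rw [moyal_eq_integral_sympFourier hθ hf hg, smul_mul_assoc, smul_mul_assoc, mul_assoc,
    ← integral_mul_const]
  congr 1
  refine integral_congr_ae (.of_forall fun z => ?_)
  simp only
  rw [Complex.ofReal_add, mul_add, Complex.exp_add]
  ring

theorem sympFourier_comp_neg (θ : ℝ) (f : EuclideanSpace ℝ (Fin D) → ℂ)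
    (k : EuclideanSpace ℝ (Fin D)) :
    sympFourier θ (fun x => f (-x)) k = sympFourier θ f (-k) := by
  rw [sympFourier, sympFourier, ← integral_neg_eq_self]
  simp [wedge_neg_left, wedge_neg_right]

theorem conj_sympFourier_ofReal (θ : ℝ) (φ : EuclideanSpace ℝ (Fin D) → ℝ)
    (k : EuclideanSpace ℝ (Fin D)) :
    (starRingEnd ℂ) (sympFourier θ (fun x => (φ x : ℂ)) k) =
      ((Real.pi * θ) ^ ((D : ℝ) / 2))⁻¹ •
        ∫ x, (φ x : ℂ) * Complex.exp (Complex.I * (wedge θ k x : ℂ)) := by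
  rw [sympFourier, Complex.real_smul, Complex.real_smul, map_mul, Complex.conj_ofReal,
    ← integral_conj]
  simp [← Complex.exp_conj]

theorem conj_sympFourier_ofReal_eq_neg (θ : ℝ) (φ : EuclideanSpace ℝ (Fin D) → ℝ)
    (k : EuclideanSpace ℝ (Fin D)) :
    (starRingEnd ℂ) (sympFourier θ (fun x => (φ x : ℂ)) k) =
      sympFourier θ (fun x => (φ x : ℂ)) (-k) := by
  rw [conj_sympFourier_ofReal, sympFourier]
  simp [wedge_neg_left]

theorem continuous_sympFourier (hθ : 0 < θ) (hD : Even D)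
    (f : 𝓢(EuclideanSpace ℝ (Fin D), ℂ)) : Continuous (sympFourier θ f) := by
  rw [funext (sympFourier_eq_fourier hθ hD f), ← SchwartzMap.fourier_coe]
  fun_prop

theorem norm_sympFourier_le (θ : ℝ) (f : EuclideanSpace ℝ (Fin D) → ℂ)
    (k : EuclideanSpace ℝ (Fin D)) :
    ‖sympFourier θ f k‖ ≤ ‖((Real.pi * θ) ^ ((D : ℝ) / 2))⁻¹‖ * ∫ x, ‖f x‖ := by
  rw [sympFourier, norm_smul]
  gcongr
  refine (norm_integral_le_integral_norm _).trans_eq ?_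
  refine integral_congr_ae (.of_forall fun x => ?_)
  have : -Complex.I * (wedge θ k x : ℂ) = ((-wedge θ k x : ℝ) : ℂ) * Complex.I := by
    push_cast; ring
  simp only [norm_mul]
  rw [this, Complex.norm_exp_ofReal_mul_I, mul_one]

theorem integral_moyal_moyal_mul_eq_integral_sympFourier (hθ : 0 < θ) (hD : Even D)
    (f : 𝓢(EuclideanSpace ℝ (Fin D), ℂ)) :
    ∫ x, moyal θ (moyal θ f f) f x * f x =
      ∫ k, moyal θ (moyal θ (fun k => sympFourier θ f (-k)) (sympFourier θ f))
        (fun k => sympFourier θ f (-k)) k * sympFourier θ f k := by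
  have hf : Integrable f := f.integrable
  have ha : Integrable (sympFourier θ f) := integrable_sympFourier hθ hD f
  have haa : sympFourier θ (sympFourier θ f) = f := sympFourier_sympFourier hθ hD f
  have ha_neg : Integrable (fun k => sympFourier θ f (-k)) := ha.comp_neg
  have haa_neg (x : EuclideanSpace ℝ (Fin D)) :
      sympFourier θ (fun k => sympFourier θ f (-k)) x = f (-x) := by
    rw [sympFourier_comp_neg, haa]
  have hf_bound (x : EuclideanSpace ℝ (Fin D)) : ‖f x‖ ≤ SchwartzMap.seminorm ℝ 0 0 f :=
    SchwartzMap.norm_le_seminorm ℝ f x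
  have ha_bound := norm_sympFourier_le θ f
  have ha_cont := continuous_sympFourier hθ hD f
  have hw := continuous_wedge θ (D := D)
  set a := sympFourier θ f with ha_def
  let G (x y z : EuclideanSpace ℝ (Fin D)) : ℂ := f (x + y + z) * (f x * a y * a z) *
    Complex.exp (Complex.I * (wedge θ z (x + y) + wedge θ y x : ℝ))
  have hw_cont {α : Type} [TopologicalSpace α] {u v : α → EuclideanSpace ℝ (Fin D)}
      (hu : Continuous u) (hv : Continuous v) : Continuous fun t => wedge θ (u t) (v t) :=
    hw.comp (hu.prodMk hv)
  have hG : Integrable (fun p : (EuclideanSpace ℝ (Fin D) × EuclideanSpace ℝ (Fin D)) ×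
      EuclideanSpace ℝ (Fin D) => G p.1.1 p.1.2 p.2) ((volume.prod volume).prod volume) := by
    refine integrable_mul_exp_I (Integrable.bdd_mul (c := SchwartzMap.seminorm ℝ 0 0 f)
      ((hf.mul_prod ha).mul_prod ha) ?_ (.of_forall fun p => hf_bound _)) ?_
    · exact (f.continuous.comp (by fun_prop)).aestronglyMeasurable
    · exact ((hw_cont (by fun_prop) (by fun_prop)).add
        (hw_cont (by fun_prop) (by fun_prop))).aestronglyMeasurable
  have hG_section (z : EuclideanSpace ℝ (Fin D)) :
      Integrable (fun p : EuclideanSpace ℝ (Fin D) × EuclideanSpace ℝ (Fin D) =>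
        G p.1 p.2 z) (volume.prod volume) := by
    refine integrable_mul_exp_I (Integrable.bdd_mul (c := SchwartzMap.seminorm ℝ 0 0 f)
      ((hf.mul_prod ha).mul_const _) ?_ (.of_forall fun p => hf_bound _)) ?_
    · exact (f.continuous.comp (by fun_prop)).aestronglyMeasurable
    · exact ((hw_cont (by fun_prop) (by fun_prop)).add
        (hw_cont (by fun_prop) (by fun_prop))).aestronglyMeasurable
  let H (z y x : EuclideanSpace ℝ (Fin D)) : ℂ := a (-(z + y + x)) * (f (-y) * f x * a z) *
    Complex.exp (Complex.I * (wedge θ x (z + y) + wedge θ y z : ℝ))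
  have hH_section (z : EuclideanSpace ℝ (Fin D)) :
      Integrable (fun p : EuclideanSpace ℝ (Fin D) × EuclideanSpace ℝ (Fin D) =>
        H z p.1 p.2) (volume.prod volume) := by
    refine integrable_mul_exp_I (Integrable.bdd_mul
      ((hf.comp_neg.mul_prod hf).mul_const _) ?_ (.of_forall fun p => ha_bound _)) ?_
    · exact (ha_cont.comp (by fun_prop)).aestronglyMeasurable
    · exact ((hw_cont (by fun_prop) (by fun_prop)).add
        (hw_cont (by fun_prop) (by fun_prop))).aestronglyMeasurable
  have hGH (z x y : EuclideanSpace ℝ (Fin D)) : H z (-(x + z) - y) x = G x y z := by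
    simp only [G, H]
    congr 1
    · rw [show -(z + (-(x + z) - y) + x) = y by abel, show -(-(x + z) - y) = x + y + z by abel]
      ring
    · congr 3
      rw [show z + (-(x + z) - y) = -x + -y by abel, show -(x + z) - y = -x + -z + -y by abel]
      simp only [wedge_add_left, wedge_add_right, wedge_neg_left, wedge_neg_right,
        wedge_self hθ.ne' hD]
      linarith [wedge_swap hθ.ne' hD x z, wedge_swap hθ.ne' hD x y, wedge_swap hθ.ne' hD y z]
  have lhs : ∫ x, moyal θ (moyal θ f f) f x * f x =
      ((Real.pi * θ) ^ D)⁻¹ • ∫ x, ∫ y, ∫ z, G x y z := by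
    rw [← integral_smul]
    refine integral_congr_ae (.of_forall fun x => ?_)
    simp only
    rw [moyal_moyal_eq_integral hθ hf hf ha hf, smul_mul_assoc]
    simp only [← integral_mul_const, ← ha_def, G]
    congr 1
    refine integral_congr_ae (.of_forall fun y => integral_congr_ae (.of_forall fun z => ?_))
    simp only
    ring
  have rhs : ∫ k, moyal θ (moyal θ (fun k => a (-k)) a) (fun k => a (-k)) k * a k =
      ((Real.pi * θ) ^ D)⁻¹ • ∫ z, ∫ y, ∫ x, H z y x := by
    rw [← integral_smul]
    refine integral_congr_ae (.of_forall fun x => ?_)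
    simp only
    rw [moyal_moyal_eq_integral hθ ha_neg ha (by rwa [haa]) ha_neg, smul_mul_assoc]
    simp only [← integral_mul_const, haa_neg, haa, H]
    congr 1
    refine integral_congr_ae (.of_forall fun y => integral_congr_ae (.of_forall fun z => ?_))
    simp only
    ring
  rw [lhs, rhs]
  congr 1
  calc ∫ x, ∫ y, ∫ z, G x y z
      = ∫ p : EuclideanSpace ℝ (Fin D) × EuclideanSpace ℝ (Fin D), ∫ z, G p.1 p.2 z
          ∂volume ∂(volume.prod volume) := (integral_prod _ hG.integral_prod_left).symm
    _ = ∫ z, ∫ p : EuclideanSpace ℝ (Fin D) × EuclideanSpace ℝ (Fin D), G p.1 p.2 z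
          ∂(volume.prod volume) ∂volume := integral_integral_swap hG
    _ = ∫ z, ∫ x, ∫ y, G x y z := by simp_rw [fun z => integral_prod _ (hG_section z)]
    _ = ∫ z, ∫ x, ∫ y, H z y x := by
        refine integral_congr_ae (.of_forall fun z => integral_congr_ae (.of_forall fun x => ?_))
        simp only [← hGH]
        exact integral_sub_left_eq_self (fun y => H z y x) volume (-(x + z))
    _ = ∫ z, ∫ y, ∫ x, H z y x :=
        integral_congr_ae (.of_forall fun z => (integral_integral_swap (hH_section z)).symm)

end Moyal

/-- Langmann–Szabo invariance of the quartic Moyal interaction: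
`∫ (φ⋆φ⋆φ⋆φ)(x) dx = ∫ (φ̂*⋆φ̂⋆φ̂*⋆φ̂)(k) dk` for real-valued Schwartz `φ`, both four-fold
Moyal products being integrable; moreover the pointwise conjugate `φ̂*` of the symplectic
Fourier transform is the transform of `φ` taken with kernel `e^{+i k∧x}`. -/
theorem langmann_szabo_quartic (D : ℕ) (hD : 0 < D) (hDeven : Even D)
    (θ : ℝ) (hθ : 0 < θ)
    (φ : SchwartzMap (EuclideanSpace ℝ (Fin D)) ℝ) :
    Integrable (moyal θ (moyal θ (moyal θ (fun x => ((φ x : ℝ) : ℂ))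
        (fun x => ((φ x : ℝ) : ℂ))) (fun x => ((φ x : ℝ) : ℂ))) (fun x => ((φ x : ℝ) : ℂ))) ∧
    Integrable (moyal θ (moyal θ (moyal θ
        (fun k => (starRingEnd ℂ) (sympFourier θ (fun x => ((φ x : ℝ) : ℂ)) k))
        (sympFourier θ (fun x => ((φ x : ℝ) : ℂ))))
        (fun k => (starRingEnd ℂ) (sympFourier θ (fun x => ((φ x : ℝ) : ℂ)) k)))
        (sympFourier θ (fun x => ((φ x : ℝ) : ℂ)))) ∧
    (∫ x : EuclideanSpace ℝ (Fin D),
        moyal θ (moyal θ (moyal θ (fun x => ((φ x : ℝ) : ℂ)) (fun x => ((φ x : ℝ) : ℂ)))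
          (fun x => ((φ x : ℝ) : ℂ))) (fun x => ((φ x : ℝ) : ℂ)) x
      = ∫ k : EuclideanSpace ℝ (Fin D),
        moyal θ (moyal θ (moyal θ
          (fun k' => (starRingEnd ℂ) (sympFourier θ (fun x => ((φ x : ℝ) : ℂ)) k'))
          (sympFourier θ (fun x => ((φ x : ℝ) : ℂ))))
          (fun k' => (starRingEnd ℂ) (sympFourier θ (fun x => ((φ x : ℝ) : ℂ)) k')))
          (sympFourier θ (fun x => ((φ x : ℝ) : ℂ))) k) ∧
    (∀ k : EuclideanSpace ℝ (Fin D),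
      (starRingEnd ℂ) (sympFourier θ (fun x => ((φ x : ℝ) : ℂ)) k)
        = ((Real.pi * θ) ^ ((D : ℝ) / 2))⁻¹ •
            ∫ x : EuclideanSpace ℝ (Fin D),
              ((φ x : ℝ) : ℂ) * Complex.exp (Complex.I * (wedge θ k x : ℂ))) := by
  set F : 𝓢(EuclideanSpace ℝ (Fin D), ℂ) := φ.postcompCLM Complex.ofRealCLM with hF
  have coe_F : (fun x => ((φ x : ℝ) : ℂ)) = F := rfl
  have conj_F : (fun k => (starRingEnd ℂ) (sympFourier θ F k)) = fun k => sympFourier θ F (-k) :=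
    funext (conj_sympFourier_ofReal_eq_neg θ φ)
  have hf : Integrable F := F.integrable
  have ha : Integrable (sympFourier θ F) := integrable_sympFourier hθ hDeven F
  have haa : sympFourier θ (sympFourier θ F) = F := sympFourier_sympFourier hθ hDeven F
  have ha' : Integrable (sympFourier θ (sympFourier θ F)) := by rwa [haa]
  have hb : Integrable (fun k => sympFourier θ F (-k)) := ha.comp_neg
  have hb' : Integrable (sympFourier θ (fun k => sympFourier θ F (-k))) := by
    rw [funext (sympFourier_comp_neg θ (sympFourier θ F))]
    exact ha'.comp_neg
  have hfff := integrable_moyal hθ (integrable_moyal hθ hf hf ha) hf ha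
  have hbab := integrable_moyal hθ (integrable_moyal hθ hb ha ha') hb hb'
  refine ⟨?_, ?_, ?_, conj_sympFourier_ofReal θ φ⟩
  · rw [coe_F]
    exact integrable_moyal hθ hfff hf ha
  · rw [coe_F, conj_F]
    exact integrable_moyal hθ hbab ha ha'
  · rw [coe_F, conj_F, integral_moyal hθ hDeven hfff hf ha, integral_moyal hθ hDeven hbab ha ha',
      haa]
    exact integral_moyal_moyal_mul_eq_integral_sympFourier hθ hDeven F
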